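/- For every positive integer n, the number of subgroups of index n in the free abelian group ℤ³ equals the divisor sum Σ_{d | n} d·σ(d), where σ(d) is the sum of divisors of d; in particular its values at n = 1, 2, 3, 4, 5, 6, 7, 8, 9, 10 are 1, 7, 13, 35, 31, 91, 57, 155, 130, 217. (The paper identifies the subgroup-cardinality sequence η_d(BR₀) of the manifold obtained by 0-surgery on all circles of the Borromean rings with OEIS A001001, the number of sublattices of index d in a 3-dimensional lattice.) -/

import Mathlib

/-- The number of subgroups of index `n` in `ℤ × ℤ × ℤ`. -/
noncomputable def sublatticeCount (n : ℕ) : ℕ :=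
  Nat.card {H : AddSubgroup (ℤ × ℤ × ℤ) // H.index = n}

namespace AddSubgroup

variable {A : Type*} [AddCommGroup A]

/-- The subgroup of `ℤ × A` generated by `0 × K` and the coset `{d} × q`. -/
def intProd (d : ℕ) (K : AddSubgroup A) (q : A ⧸ K) : AddSubgroup (ℤ × A) where
  carrier := {x | ∃ m : ℤ, x.1 = m * d ∧ (x.2 : A ⧸ K) = m • q}
  zero_mem' := ⟨0, by simp⟩
  add_mem' := by
    rintro x y ⟨m, hm, hm'⟩ ⟨l, hl, hl'⟩
    exact ⟨m + l, by simp [hm, hl, add_mul], by simp [hm', hl', add_smul]⟩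
  neg_mem' := by
    rintro x ⟨m, hm, hm'⟩
    exact ⟨-m, by simp [hm], by simp [hm']⟩

theorem mem_intProd {d : ℕ} {K : AddSubgroup A} {q : A ⧸ K} {x : ℤ × A} :
    x ∈ intProd d K q ↔ ∃ m : ℤ, x.1 = m * d ∧ (x.2 : A ⧸ K) = m • q :=
  Iff.rfl

theorem comap_inr_intProd {d : ℕ} (hd : d ≠ 0) (K : AddSubgroup A) (q : A ⧸ K) :
    (intProd d K q).comap (AddMonoidHom.inr ℤ A) = K := by
  ext a
  simp only [mem_comap, mem_intProd, AddMonoidHom.inr_apply]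
  constructor
  · rintro ⟨m, hm, hm'⟩
    obtain rfl : m = 0 := by simpa [hd] using hm.symm
    simpa using hm'
  · intro ha
    exact ⟨0, by simp, by simpa using ha⟩

theorem map_fst_intProd (d : ℕ) (K : AddSubgroup A) (q : A ⧸ K) :
    (intProd d K q).map (AddMonoidHom.fst ℤ A) = zmultiples (d : ℤ) := by
  ext z
  simp only [mem_map, mem_intProd, Int.mem_zmultiples_iff]
  constructor
  · rintro ⟨x, ⟨m, hm, -⟩, rfl⟩
    exact ⟨m, by simp [hm, mul_comm]⟩
  · rintro ⟨m, rfl⟩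
    obtain ⟨a, ha⟩ := QuotientAddGroup.mk_surjective (m • q)
    exact ⟨(d * m, a), ⟨m, mul_comm _ _, ha⟩, rfl⟩

theorem mk_mem_intProd_iff {d : ℕ} (hd : d ≠ 0) {K : AddSubgroup A} {q : A ⧸ K} {a : A} :
    ((d : ℤ), a) ∈ intProd d K q ↔ (a : A ⧸ K) = q := by
  rw [mem_intProd]
  constructor
  · rintro ⟨m, hm, hm'⟩
    obtain rfl : m = 1 := by
      have : (d : ℤ) ≠ 0 := by exact_mod_cast hd
      exact mul_right_cancel₀ this (by simpa using hm.symm)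
    simpa using hm'
  · intro h
    exact ⟨1, by simp, by simpa using h⟩

theorem index_eq_index_map_fst_mul {B : Type*} [AddCommGroup B] (H : AddSubgroup (B × A)) :
    H.index = (H.map (AddMonoidHom.fst B A)).index * (H.comap (AddMonoidHom.inr B A)).index := by
  have hker : (AddMonoidHom.fst B A).ker = (AddMonoidHom.inr B A).range := by
    ext ⟨b, a⟩
    simp [AddMonoidHom.mem_range, mem_prod, eq_comm]
  have hrange : (AddMonoidHom.fst B A).range = ⊤ :=
    AddMonoidHom.range_eq_top.2 Prod.fst_surjective
  rw [index_map, hrange, index_top, mul_one, index_comap, hker, ← relIndex_sup_right,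
    mul_comm, sup_comm H, relIndex_mul_index le_sup_right]

theorem eq_zmultiples_index (H : AddSubgroup ℤ) : H = zmultiples (H.index : ℤ) := by
  obtain ⟨a, rfl⟩ := Int.subgroup_cyclic H
  rw [← zmultiples_eq_closure, Int.index_zmultiples, Int.zmultiples_natAbs]

theorem exists_eq_intProd (H : AddSubgroup (ℤ × A)) :
    ∃ q, H = intProd (H.map (AddMonoidHom.fst ℤ A)).index
      (H.comap (AddMonoidHom.inr ℤ A)) q := by
  set d := (H.map (AddMonoidHom.fst ℤ A)).index
  have hH : H.map (AddMonoidHom.fst ℤ A) = zmultiples (d : ℤ) := eq_zmultiples_index _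
  obtain ⟨⟨-, a⟩, ha, rfl : _ = (d : ℤ)⟩ :
      (d : ℤ) ∈ H.map (AddMonoidHom.fst ℤ A) := hH ▸ mem_zmultiples _
  have key (m : ℤ) (b : A) : (m * d, b) ∈ H ↔
      (b : A ⧸ H.comap (AddMonoidHom.inr ℤ A)) = m • (a : A ⧸ H.comap _) := by
    rw [← QuotientAddGroup.mk_zsmul, eq_comm, QuotientAddGroup.eq, mem_comap,
      ← H.add_mem_cancel_left (H.neg_mem (H.zsmul_mem ha m))]
    simp
  refine ⟨a, ext fun x => ?_⟩
  rw [mem_intProd]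
  constructor
  · intro hx
    obtain ⟨m, hm⟩ := Int.mem_zmultiples_iff.1 (hH ▸ mem_map_of_mem _ hx)
    have hm : x.1 = m * d := by simpa [mul_comm] using hm
    exact ⟨m, hm, (key m x.2).1 (by rwa [← hm])⟩
  · rintro ⟨m, hm, hm'⟩
    have := (key m x.2).2 hm'
    rwa [← hm] at this

/-- The subgroup of index `n` in `ℤ × A` attached to a subgroup `K` of `A` whose index divides
`n`, together with a coset of `K`. -/
def intProdOfIndex (n : ℕ)
    (x : Σ k : n.divisors, Σ K : {K : AddSubgroup A // K.index = k}, A ⧸ K.1) :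
    {H : AddSubgroup (ℤ × A) // H.index = n} :=
  ⟨intProd (n / x.1) x.2.1.1 x.2.2, by
    obtain ⟨⟨k, hk⟩, ⟨K, hK⟩, q⟩ := x
    have hd : n / k ≠ 0 :=
      (Nat.div_pos (Nat.divisor_le hk) (Nat.pos_of_mem_divisors hk)).ne'
    dsimp only at hK ⊢
    rw [index_eq_index_map_fst_mul, map_fst_intProd, comap_inr_intProd hd, Int.index_zmultiples,
      Int.natAbs_natCast, hK, Nat.div_mul_cancel (Nat.dvd_of_mem_divisors hk)]⟩

theorem intProdOfIndex_bijective {n : ℕ} (hn : 0 < n) :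
    Function.Bijective (intProdOfIndex (A := A) n) := by
  constructor
  · rintro ⟨k, ⟨K, hK⟩, q⟩ ⟨k', ⟨K', hK'⟩, q'⟩ h
    have h : intProd (n / k) K q = intProd (n / k') K' q' := congrArg Subtype.val h
    have hd (l : n.divisors) : n / l ≠ 0 :=
      (Nat.div_pos (Nat.divisor_le l.2) (Nat.pos_of_mem_divisors l.2)).ne'
    obtain rfl : K = K' := by
      rw [← comap_inr_intProd (hd k) K q, h, comap_inr_intProd (hd k')]
    obtain rfl : k = k' := Subtype.ext (hK.symm.trans hK')
    obtain rfl : q = q' := by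
      obtain ⟨a, rfl⟩ := QuotientAddGroup.mk_surjective q
      exact (mk_mem_intProd_iff (hd k)).1 (h ▸ (mk_mem_intProd_iff (hd k)).2 rfl)
    rfl
  · rintro ⟨H, rfl⟩
    obtain ⟨q, hq⟩ := exists_eq_intProd H
    have hmul := index_eq_index_map_fst_mul H
    have hpos : 0 < (H.comap (AddMonoidHom.inr ℤ A)).index :=
      Nat.pos_of_mul_pos_left (hmul ▸ hn)
    refine ⟨⟨⟨_, Nat.mem_divisors.2 ⟨Dvd.intro_left _ hmul.symm, hn.ne'⟩⟩, ⟨_, rfl⟩, q⟩,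
      Subtype.ext ?_⟩
    simp only [intProdOfIndex]
    conv_rhs => rw [hq]
    congr 1
    rw [hmul, Nat.mul_div_cancel _ hpos]

theorem finite_quotient_of_index_mem_divisors {n : ℕ} {k : n.divisors}
    (K : {K : AddSubgroup A // K.index = k}) : Finite (A ⧸ K.1) := by
  have : K.1.FiniteIndex := ⟨by rw [K.2]; exact (Nat.pos_of_mem_divisors k.2).ne'⟩
  infer_instance

theorem finite_index_eq_int_prod
    (hA : ∀ k : ℕ, 0 < k → Finite {K : AddSubgroup A // K.index = k}) {n : ℕ} (hn : 0 < n) :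
    Finite {H : AddSubgroup (ℤ × A) // H.index = n} := by
  have (k : n.divisors) := hA k (Nat.pos_of_mem_divisors k.2)
  have {k : n.divisors} := finite_quotient_of_index_mem_divisors (A := A) (k := k)
  exact Finite.of_surjective _ (intProdOfIndex_bijective hn).2

theorem card_index_eq_int_prod
    (hA : ∀ k : ℕ, 0 < k → Finite {K : AddSubgroup A // K.index = k}) {n : ℕ} (hn : 0 < n) :
    Nat.card {H : AddSubgroup (ℤ × A) // H.index = n} =
      ∑ k ∈ n.divisors, k * Nat.card {K : AddSubgroup A // K.index = k} := by
  have (k : n.divisors) := hA k (Nat.pos_of_mem_divisors k.2)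
  have {k : n.divisors} := finite_quotient_of_index_mem_divisors (A := A) (k := k)
  have (k : n.divisors) := Fintype.ofFinite {K : AddSubgroup A // K.index = k}
  rw [← Nat.card_congr (Equiv.ofBijective _ (intProdOfIndex_bijective hn)), Nat.card_sigma,
    ← Finset.sum_coe_sort n.divisors]
  refine Finset.sum_congr rfl fun k _ => ?_
  have hK (K : {K : AddSubgroup A // K.index = k}) : Nat.card (A ⧸ K.1) = k := K.2
  simp [Nat.card_sigma, hK, mul_comm]

/-- The group `ℤ` has a unique subgroup of each index. -/
instance uniqueIndexEqInt (n : ℕ) : Unique {H : AddSubgroup ℤ // H.index = n} where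
  default := ⟨zmultiples (n : ℤ), by simp⟩
  uniq := by
    rintro ⟨H, rfl⟩
    exact Subtype.ext (eq_zmultiples_index H)

theorem card_index_eq_int_prod_int {n : ℕ} (hn : 0 < n) :
    Nat.card {H : AddSubgroup (ℤ × ℤ) // H.index = n} = ArithmeticFunction.sigma 1 n := by
  rw [card_index_eq_int_prod (fun _ _ => inferInstance) hn]
  simp [ArithmeticFunction.sigma_one_apply]

theorem card_index_eq_int_prod_int_prod_int {n : ℕ} (hn : 0 < n) :
    Nat.card {H : AddSubgroup (ℤ × ℤ × ℤ) // H.index = n} =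
      ∑ d ∈ n.divisors, d * ArithmeticFunction.sigma 1 d := by
  rw [card_index_eq_int_prod
    (fun _ hk => finite_index_eq_int_prod (fun _ _ => inferInstance) hk) hn]
  exact Finset.sum_congr rfl fun k hk => by
    rw [card_index_eq_int_prod_int (Nat.pos_of_mem_divisors hk)]

end AddSubgroup

theorem count_index_n_subgroups_Z3 :
    (∀ n : ℕ, 0 < n →
      sublatticeCount n = ∑ d ∈ n.divisors, d * ArithmeticFunction.sigma 1 d) ∧
    sublatticeCount 1 = 1 ∧ sublatticeCount 2 = 7 ∧ sublatticeCount 3 = 13 ∧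
    sublatticeCount 4 = 35 ∧ sublatticeCount 5 = 31 ∧ sublatticeCount 6 = 91 ∧
    sublatticeCount 7 = 57 ∧ sublatticeCount 8 = 155 ∧ sublatticeCount 9 = 130 ∧
    sublatticeCount 10 = 217 := by
  have h (n : ℕ) (hn : 0 < n) :
      sublatticeCount n = ∑ d ∈ n.divisors, d * ArithmeticFunction.sigma 1 d :=
    AddSubgroup.card_index_eq_int_prod_int_prod_int hn
  refine ⟨h, ?_, ?_, ?_, ?_, ?_, ?_, ?_, ?_, ?_, ?_⟩ <;>
  · rw [h _ (Nat.succ_pos _)]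
    simp only [ArithmeticFunction.sigma_one_apply]
    decide
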